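/- Let p ≥ 5 be a prime. There does not exist a regular (8p^3, 4p^2+2p+1, 2p+4, 2p+2)-partial difference set in any Abelian group of order 8p^3. -/

import Mathlib

variable {G : Type*} [CommGroup G] [DecidableEq G] [Fintype G]

/-- The number of representations of `g` as `d₁ * d₂⁻¹` with `d₁, d₂ ∈ D`, `d₁ ≠ d₂`. -/
def pdsReps (D : Finset G) (g : G) : ℕ :=
  ((D ×ˢ D).filter (fun x => x.1 ≠ x.2 ∧ x.1 * x.2⁻¹ = g)).card

/-- `D` is a `(v,k,λ,μ)`-partial difference set in `G`. -/
def IsPDS (D : Finset G) (v k l m : ℕ) : Prop :=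
  Fintype.card G = v ∧ D.card = k ∧
  (∀ g : G, g ≠ 1 → g ∈ D → pdsReps D g = l) ∧
  (∀ g : G, g ≠ 1 → g ∉ D → pdsReps D g = m)

/-- `D` is regular: closed under inverses and not containing the identity. -/
def IsRegularPDS (D : Finset G) : Prop :=
  (∀ d ∈ D, d⁻¹ ∈ D) ∧ (1 : G) ∉ D

/-- A regular PDS is trivial if `D ∪ {e}` or `G \ D` is a subgroup. -/
def IsTrivialPDS (D : Finset G) : Prop :=
  (∃ H : Subgroup G, (H : Set G) = ↑D ∪ {1}) ∨
  (∃ H : Subgroup G, (H : Set G) = (↑D : Set G)ᶜ)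

/-- In a finite group of `p`-power order, a set of non-identity elements that is closed under
powers prime to `p` has cardinality divisible by `p - 1`. -/
theorem sub_one_dvd_card_of_pow_closed {X : Type*} [Group X] {p : ℕ} (hp : p.Prime)
    (hX : ∀ x : X, ∃ i, orderOf x = p ^ i) (S : Finset X) (h1 : (1 : X) ∉ S)
    (hS : ∀ x ∈ S, ∀ s : ℕ, s.Coprime p → x ^ s ∈ S) : p - 1 ∣ S.card := by
  classical
  rw [Finset.card_eq_sum_card_image (fun x => Subgroup.zpowers x) S]
  refine Finset.dvd_sum fun H hH => ?_
  obtain ⟨x, hxS, rfl⟩ := Finset.mem_image.1 hH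
  obtain ⟨i, hi⟩ := hX x
  have hi0 : 0 < i := by
    rcases Nat.eq_zero_or_pos i with rfl | h
    · rw [pow_zero, orderOf_eq_one_iff] at hi
      exact absurd (hi ▸ hxS) h1
    · exact h
  have hfin : IsOfFinOrder x := by
    rw [← orderOf_pos_iff, hi]; exact pow_pos hp.pos _
  have hcard : (orderOf x).totient =
      (S.filter fun y => Subgroup.zpowers y = Subgroup.zpowers x).card := by
    rw [Nat.totient]
    refine Finset.card_bij (fun s _ => x ^ s) ?_ ?_ ?_
    · intro s hs
      rw [Finset.mem_filter, Finset.mem_range] at hs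
      have hcop : s.Coprime p := by
        have := hs.2
        rw [hi, Nat.coprime_pow_left_iff hi0] at this
        exact this.symm
      refine Finset.mem_filter.2 ⟨hS x hxS s hcop, le_antisymm ?_ ?_⟩
      · rw [Subgroup.zpowers_le]
        exact Subgroup.npow_mem_zpowers x s
      · rw [Subgroup.zpowers_le, mem_zpowers_pow_iff]
        simpa [Nat.Coprime, Nat.gcd_comm] using hs.2
    · intro s hs t ht hst
      rw [Finset.mem_filter, Finset.mem_range] at hs ht
      exact pow_injOn_Iio_orderOf hs.1 ht.1 hst
    · intro y hy
      obtain ⟨hyS, hyx⟩ := Finset.mem_filter.1 hy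
      have hyz : y ∈ Subgroup.zpowers x := hyx ▸ Subgroup.mem_zpowers y
      rw [hfin.mem_zpowers_iff_mem_range_orderOf] at hyz
      obtain ⟨s, hs, rfl⟩ := Finset.mem_image.1 hyz
      refine ⟨s, Finset.mem_filter.2 ⟨hs, ?_⟩, rfl⟩
      have hxz : x ∈ Subgroup.zpowers (x ^ s) := hyx ▸ Subgroup.mem_zpowers x
      rw [mem_zpowers_pow_iff] at hxz
      simpa [Nat.Coprime, Nat.gcd_comm] using hxz
  rw [← hcard, hi, Nat.totient_prime_pow hp hi0]
  exact Dvd.intro_left _ rfl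

/-- A sum of `n`-th roots of unity that is an integer is invariant under raising every summand
to a power prime to `n`. -/
theorem sum_pow_eq_of_sum_eq_int {ι : Type*} (D : Finset ι) (u : ι → ℂ) {n s : ℕ} (hn : 0 < n)
    (hu : ∀ d, u d ^ n = 1) (hs : s.Coprime n) {c : ℤ} (hc : ∑ d ∈ D, u d = c) :
    ∑ d ∈ D, u d ^ s = c := by
  have hζ := Complex.isPrimitiveRoot_exp n hn.ne'
  set ζ := Complex.exp (2 * Real.pi * Complex.I / n)
  have : NeZero n := ⟨hn.ne'⟩
  choose j _ hj using fun d => hζ.eq_pow_of_pow_eq_one (hu d)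
  let P : Polynomial ℤ := ∑ d ∈ D, Polynomial.X ^ j d - Polynomial.C c
  have hP : ∀ z : ℂ, Polynomial.aeval z P = ∑ d ∈ D, z ^ j d - c := fun z => by
    simp [P]
  have h0 : Polynomial.aeval ζ P = 0 := by
    rw [hP, sub_eq_zero, ← hc]
    exact Finset.sum_congr rfl fun d _ => hj d
  have hdvd : minpoly ℤ ζ ∣ P := minpoly.isIntegrallyClosed_dvd (hζ.isIntegral hn) h0
  rw [hζ.minpoly_eq_pow_coprime hs] at hdvd
  have h1 : Polynomial.aeval (ζ ^ s) P = 0 := by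
    obtain ⟨R, hR⟩ := hdvd
    rw [hR, map_mul, minpoly.aeval, zero_mul]
  rw [hP, sub_eq_zero] at h1
  rw [← h1]
  refine Finset.sum_congr rfl fun d _ => ?_
  rw [← hj d, ← pow_mul, ← pow_mul, mul_comm]

/-- The quadratic equation satisfied by a nontrivial character sum over a regular partial
difference set. -/
theorem IsPDS.sq_sum_character {G : Type*} [CommGroup G] [DecidableEq G] [Fintype G]
    {D : Finset G} {v k l m : ℕ} (hD : IsPDS D v k l m) (hreg : IsRegularPDS D)
    (χ : G →* ℂ) (hχ : χ ≠ 1) :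
    (∑ d ∈ D, χ d) ^ 2 = k - m + ((l : ℂ) - m) * ∑ d ∈ D, χ d := by
  obtain ⟨-, hk, hl, hm⟩ := hD
  have hinv : ∑ d ∈ D, χ d = ∑ d ∈ D, χ d⁻¹ :=
    Finset.sum_bij' (fun d _ => d⁻¹) (fun d _ => d⁻¹) (fun d hd => hreg.1 d hd)
      (fun d hd => hreg.1 d hd) (by simp) (by simp) (by simp)
  have hreps : ∀ g : G, (pdsReps D g : ℂ) =
      m + (if g ∈ D then (l : ℂ) - m else 0) - (if g = 1 then (m : ℂ) else 0) := by
    intro g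
    by_cases hg : g = 1
    · subst hg
      have : pdsReps D 1 = 0 := by
        rw [pdsReps, Finset.card_eq_zero, Finset.filter_eq_empty_iff]
        rintro x - ⟨hne, he⟩
        exact hne (mul_inv_eq_one.1 he)
      simp [this, hreg.2]
    · by_cases hgD : g ∈ D
      · simp [hg, hgD, hl g hg hgD]
      · simp [hg, hgD, hm g hg hgD]
  have hsq : (∑ d ∈ D, χ d) ^ 2 = ∑ x ∈ D ×ˢ D, χ (x.1 * x.2⁻¹) := by
    rw [sq]
    nth_rewrite 2 [hinv]
    rw [Finset.sum_mul_sum, Finset.sum_product]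
    simp
  have hdiag : ∑ x ∈ (D ×ˢ D).filter (fun x => ¬ x.1 ≠ x.2), χ (x.1 * x.2⁻¹) = k := by
    have : ∀ x ∈ (D ×ˢ D).filter (fun x => ¬ x.1 ≠ x.2), χ (x.1 * x.2⁻¹) = 1 := by
      intro x hx
      have := not_not.1 (Finset.mem_filter.1 hx).2
      simp [this]
    rw [Finset.sum_congr rfl this, Finset.sum_const, nsmul_eq_mul, mul_one, ← hk]
    congr 1
    simp only [not_not]
    rw [← Finset.diag_card D]
    congr 1
    ext x
    simp only [Finset.mem_filter, Finset.mem_product, Finset.mem_diag]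
    exact ⟨fun h => ⟨h.1.1, h.2⟩, fun h => ⟨⟨h.1, h.2 ▸ h.1⟩, h.2⟩⟩
  have hoff : ∑ x ∈ (D ×ˢ D).filter (fun x => x.1 ≠ x.2), χ (x.1 * x.2⁻¹) =
      ∑ g : G, (pdsReps D g : ℂ) * χ g := by
    rw [← Finset.sum_fiberwise _ (fun x : G × G => x.1 * x.2⁻¹)]
    refine Finset.sum_congr rfl fun g _ => ?_
    rw [Finset.filter_filter, pdsReps, ← nsmul_eq_mul, ← Finset.sum_const]
    exact Finset.sum_congr rfl fun x hx => by rw [(Finset.mem_filter.1 hx).2.2]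
  have hsum : ∑ g : G, χ g = 0 := sum_hom_units_eq_zero χ hχ
  rw [hsq, ← Finset.sum_filter_add_sum_filter_not _ (fun x : G × G => x.1 ≠ x.2), hdiag, hoff]
  simp only [hreps, add_mul, sub_mul, Finset.sum_add_distrib, Finset.sum_sub_distrib,
    ← Finset.mul_sum, hsum, ite_mul, zero_mul]
  rw [← Finset.sum_filter, Finset.filter_mem_eq_inter, Finset.univ_inter,
    Finset.sum_ite_eq' Finset.univ 1]
  simp [Finset.mul_sum, Finset.sum_sub_distrib]
  ring

/-- In a commutative group of order `8 p ^ 3`, the eighth power map has kernel of order `8` and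
image of order `p ^ 3`. -/
theorem card_ker_and_range_pow_eight {G : Type*} [CommGroup G] [Fintype G] {p : ℕ} (hp : p.Prime)
    (hp5 : 5 ≤ p) (hG : Fintype.card G = 8 * p ^ 3) :
    Nat.card (powMonoidHom 8 : G →* G).ker = 8 ∧
      Nat.card (powMonoidHom 8 : G →* G).range = p ^ 3 := by
  have : Fact p.Prime := ⟨hp⟩
  have : Fact (Nat.Prime 2) := ⟨Nat.prime_two⟩
  have hcop : Nat.Coprime 2 p := (Nat.coprime_primes Nat.prime_two hp).2 (by omega)
  have hmul : Nat.card (powMonoidHom 8 : G →* G).ker *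
      Nat.card (powMonoidHom 8 : G →* G).range = 8 * p ^ 3 := by
    rw [← Subgroup.index_ker, Subgroup.card_mul_index, Nat.card_eq_fintype_card, hG]
  have hker : IsPGroup 2 (powMonoidHom 8 : G →* G).ker := by
    rintro ⟨x, hx⟩
    refine ⟨3, Subtype.ext ?_⟩
    simpa using hx
  have hrange : IsPGroup p (powMonoidHom 8 : G →* G).range := by
    rintro ⟨_, x, rfl⟩
    refine ⟨3, Subtype.ext ?_⟩
    simp [← pow_mul, ← hG]
  obtain ⟨a, ha⟩ := hker.exists_card_eq
  obtain ⟨b, hb⟩ := hrange.exists_card_eq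
  have h8 : (8 : ℕ) = 2 ^ 3 := rfl
  have h1 : Nat.card (powMonoidHom 8 : G →* G).ker ∣ 8 := by
    refine Nat.Coprime.dvd_of_dvd_mul_right ?_ (Dvd.intro _ hmul)
    rw [ha]; exact hcop.pow _ _
  have h2 : 8 ∣ Nat.card (powMonoidHom 8 : G →* G).ker := by
    refine Nat.Coprime.dvd_of_dvd_mul_right ?_ (Dvd.intro _ hmul.symm)
    rw [hb, h8]; exact hcop.pow _ _
  have h3 := Nat.dvd_antisymm h1 h2
  rw [h3] at hmul
  exact ⟨h3, by omega⟩

/-- The counting equation for the characters taking the larger value has no admissible solution. -/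
theorem counting_equation_unsolvable {p M x : ℤ} (hp : 5 ≤ p) (hodd : p % 2 = 1) (hx0 : 0 ≤ x)
    (hx7 : x ≤ 7)
    (h : p ^ 2 * (x - 1) = 4 * p + 4 - 2 * p ^ 3 + 4 * ((p - 1) * M)) : False := by
  have key : ∀ c : ℤ, (p - 1) * c = 2 → False := by
    intro c hc
    have : p - 1 ≤ 2 := Int.le_of_dvd (by norm_num) (Dvd.intro _ hc)
    omega
  obtain ⟨q, rfl⟩ : ∃ q, p = 2 * q + 1 := ⟨p / 2, by omega⟩
  have hmod : 4 ∣ x - 3 := by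
    refine ⟨2 * q + 2 - (4 * q ^ 3 + 6 * q ^ 2 + 3 * q + 1) - (q ^ 2 + q) * (x - 1) + 2 * q * M, ?_⟩
    linear_combination h
  obtain rfl | rfl : x = 3 ∨ x = 7 := by omega
  · refine key ((2 * q + 1) ^ 2 + 2 * (2 * q + 1) - 2 * M) ?_
    linarith
  · have h' : (2 * q) * ((2 * q + 1) ^ 2 + 4 * (2 * q + 1) + 2 - 2 * M) = 0 := by
      linarith
    rcases mul_eq_zero.1 h' with h0 | h0
    · omega
    · have : 2 * (2 * q ^ 2 + 6 * q + 3 - M) = -1 := by linarith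
      omega

/-- There is no regular `(8p^3, 4p^2+2p+1, 2p+4, 2p+2)`-PDS in an Abelian group,
for `p ≥ 5` prime. -/
theorem no_pds_case2 (p : ℕ) (hp : p.Prime) (hp5 : 5 ≤ p)
    {G : Type*} [CommGroup G] [DecidableEq G] [Fintype G]
    (D : Finset G) :
    ¬ (IsPDS D (8 * p ^ 3) (4 * p ^ 2 + 2 * p + 1) (2 * p + 4) (2 * p + 2) ∧
        IsRegularPDS D) := by
  classical
  rintro ⟨hD, hreg⟩
  obtain ⟨hker, hrange⟩ := card_ker_and_range_pow_eight hp hp5 hD.1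
  let f : G →* G := powMonoidHom 8
  let A := Additive f.range
  let r : G → A := fun g => Additive.ofMul (f.rangeRestrict g)
  have hA : Fintype.card A = p ^ 3 := by rw [← Nat.card_eq_fintype_card]; exact hrange
  have hr1 : r 1 = 0 := by simp [r]
  have hrmul : ∀ a b, r (a * b) = r a + r b := fun a b => by simp [r]
  have hrsurj : Function.Surjective r := f.rangeRestrict_surjective
  have hpow : ∀ (ψ : AddChar A ℂ) (a : A), ψ a ^ p ^ 3 = 1 := fun ψ a => by
    rw [← hA, ← AddChar.map_nsmul_eq_pow, card_nsmul_eq_zero, AddChar.map_zero_eq_one]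
  let F : AddChar A ℂ → ℂ := fun ψ => ∑ d ∈ D, ψ (r d)
  have hval : ∀ ψ : AddChar A ℂ, ψ ≠ 1 → F ψ = 1 + 2 * p ∨ F ψ = 1 - 2 * p := by
    intro ψ hψ
    let χ : G →* ℂ :=
      { toFun := fun g => ψ (r g)
        map_one' := by rw [hr1, AddChar.map_zero_eq_one]
        map_mul' := fun a b => by rw [hrmul, AddChar.map_add_eq_mul] }
    have hχ : χ ≠ 1 := by
      intro h
      apply hψ
      ext a
      obtain ⟨g, rfl⟩ := hrsurj a
      exact DFunLike.congr_fun h g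
    have hq : F ψ ^ 2 = _ := hD.sq_sum_character hreg χ hχ
    change _ = _ + _ * F ψ at hq
    push_cast at hq
    have : (F ψ - (1 + 2 * p)) * (F ψ - (1 - 2 * p)) = 0 := by linear_combination hq
    rcases mul_eq_zero.1 this with h | h
    · exact Or.inl (sub_eq_zero.1 h)
    · exact Or.inr (sub_eq_zero.1 h)
  let S : Finset (AddChar A ℂ) := (Finset.univ.erase 1).filter fun ψ => F ψ = 1 + 2 * p
  have horder : ∀ ψ : AddChar A ℂ, ψ ^ p ^ 3 = 1 := fun ψ => by
    ext a
    rw [AddChar.pow_apply, hpow, AddChar.one_apply]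
  have hS : p - 1 ∣ S.card := by
    refine sub_one_dvd_card_of_pow_closed hp
      (fun ψ => ?_) S (by simp [S]) fun ψ hψ s hs => ?_
    · obtain ⟨i, -, hi⟩ := (Nat.dvd_prime_pow hp).1 (orderOf_dvd_of_pow_eq_one (horder ψ))
      exact ⟨i, hi⟩
    · simp only [S, Finset.mem_filter, Finset.mem_erase, Finset.mem_univ, and_true] at hψ ⊢
      refine ⟨fun h => hψ.1 ?_, ?_⟩
      · have hd := Nat.dvd_gcd (orderOf_dvd_of_pow_eq_one h)
          (orderOf_dvd_of_pow_eq_one (horder ψ))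
        rw [Nat.Coprime.pow_right 3 hs, Nat.dvd_one, orderOf_eq_one_iff] at hd
        exact hd
      · have := sum_pow_eq_of_sum_eq_int D (fun d => ψ (r d)) (n := p ^ 3) (s := s)
          (c := 1 + 2 * p) (pow_pos hp.pos 3) (fun d => hpow ψ _) (hs.pow_right 3)
          (by push_cast; exact hψ.2)
        push_cast at this
        simpa [F, AddChar.pow_apply] using this
  have hx : (D.filter fun d => r d = 0).card ≤ 7 := by
    have hsub : insert (1 : G) (D.filter fun d => r d = 0) ⊆
        Finset.univ.filter fun d => d ∈ f.ker := by
      intro d hd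
      rw [Finset.mem_filter]
      refine ⟨Finset.mem_univ _, ?_⟩
      rcases Finset.mem_insert.1 hd with rfl | hd
      · exact one_mem _
      · exact congrArg Subtype.val (Finset.mem_filter.1 hd).2
    have hc := Finset.card_le_card hsub
    rw [Finset.card_insert_of_notMem fun h => hreg.2 (Finset.mem_filter.1 h).1,
      ← Fintype.card_subtype, ← Nat.card_eq_fintype_card] at hc
    have : Nat.card {d // d ∈ f.ker} = 8 := hker
    omega
  have hsum1 : ∑ ψ : AddChar A ℂ, F ψ = p ^ 3 * (D.filter fun d => r d = 0).card := by
    rw [Finset.sum_comm]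
    simp only [AddChar.sum_apply_eq_ite, hA]
    rw [← Finset.sum_filter, Finset.sum_const, nsmul_eq_mul]
    push_cast
    ring
  have hF1 : F 1 = 4 * p ^ 2 + 2 * p + 1 := by
    simp [F, hD.2.1]
  have hsum2 : ∑ ψ : AddChar A ℂ, F ψ =
      4 * p ^ 2 + 2 * p + 1 + ((p ^ 3 - 1) * (1 - 2 * p) + S.card * (4 * p)) := by
    rw [← Finset.add_sum_erase _ _ (Finset.mem_univ 1), hF1]
    congr 1
    have : ∀ ψ ∈ (Finset.univ.erase 1 : Finset (AddChar A ℂ)),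
        F ψ = (1 - 2 * p) + if F ψ = 1 + 2 * p then 4 * (p : ℂ) else 0 := by
      intro ψ hψ
      split_ifs with h
      · rw [h]; ring
      · rw [(hval ψ (Finset.ne_of_mem_erase hψ)).resolve_left h, add_zero]
    rw [Finset.sum_congr rfl this, Finset.sum_add_distrib, Finset.sum_const,
      Finset.card_erase_of_mem (Finset.mem_univ _), Finset.card_univ, AddChar.card_eq, hA,
      ← Finset.sum_filter, Finset.sum_const, nsmul_eq_mul, nsmul_eq_mul,
      Nat.cast_sub (Nat.one_le_pow _ _ hp.pos)]
    push_cast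
    rfl
  obtain ⟨M, hM⟩ := hS
  have hp1 : ((p - 1 : ℕ) : ℤ) = p - 1 := by omega
  have hmain := hsum1.symm.trans hsum2
  rw [hM] at hmain
  have hZ : (p : ℤ) ^ 3 * (D.filter fun d => r d = 0).card =
      4 * p ^ 2 + 2 * p + 1 + ((p ^ 3 - 1) * (1 - 2 * p) + ((p - 1 : ℕ) * M : ℤ) * (4 * p)) := by
    exact_mod_cast hmain
  rw [hp1] at hZ
  have hp0 : (p : ℤ) ≠ 0 := by exact_mod_cast hp.ne_zero
  refine counting_equation_unsolvable (p := p) (M := M) (x := (D.filter fun d => r d = 0).card)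
    (by exact_mod_cast hp5) ?_ (by positivity) (by exact_mod_cast hx) ?_
  · have := hp.eq_two_or_odd
    omega
  · refine mul_left_cancel₀ hp0 ?_
    linear_combination hZ
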